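/- Let p be a fixed point of the HK interactive Markov chain and let i ∈ {1,…,n} with p i > 0. Let S := {j ∈ {1,…,n} | p j > 0 and i−1 < M_j < i+1}; then i ∈ S, and writing a := min S and b := max S, the mass of p vanishes on [a−ε..a−1] if and only if it vanishes on [b+1..b+ε]; that is, (∀ m ∈ [a−ε..a−1], p m = 0) ↔ (∀ m ∈ [b+1..b+ε], p m = 0). -/

import Mathlib

open Finset
open scoped Classical

/-- `p : ℤ → ℝ` is an opinion distribution on the classes `{1,…,n}`:
nonnegative, vanishing outside `{1,…,n}`, summing to `1`. -/
def IsDist (n : ℤ) (p : ℤ → ℝ) : Prop :=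
  (∀ m, 0 ≤ p m) ∧ (∀ m, m ∉ Finset.Icc (1:ℤ) n → p m = 0) ∧
    (∑ k ∈ Finset.Icc (1:ℤ) n, p k) = 1

/-- The barycenter `M^bary_{[a..b]}(p)`: the mean class of `p` on `[a..b]`,
and the midpoint `(a+b)/2` if `p` has no mass there. -/
noncomputable def Mbary (p : ℤ → ℝ) (a b : ℤ) : ℝ :=
  if (∑ k ∈ Finset.Icc a b, p k) ≠ 0 then
    (∑ k ∈ Finset.Icc a b, (k:ℝ) * p k) / (∑ k ∈ Finset.Icc a b, p k)
  else ((a:ℝ) + (b:ℝ)) / 2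

/-- The `ε`-local mean `M_i = M^bary_{[i-ε..i+ε]}(p)`. -/
noncomputable def locM (p : ℤ → ℝ) (ε i : ℤ) : ℝ := Mbary p (i - ε) (i + ε)

/-- The Hegselmann–Krause transition matrix `B^HK(p,ε)` on `{1,…,n} × {1,…,n}`. -/
noncomputable def BHK (p : ℤ → ℝ) (ε i j : ℤ) : ℝ :=
  if (j:ℝ) = locM p ε i then 1
  else if j = ⌊locM p ε i⌋ then (⌈locM p ε i⌉ : ℝ) - locM p ε i
  else if j = ⌈locM p ε i⌉ then locM p ε i - (⌊locM p ε i⌋ : ℝ)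
  else 0

/-- One step of the HK interactive Markov chain: `(pB^HK(p,ε)) k`. -/
noncomputable def stepHK (n : ℤ) (p : ℤ → ℝ) (ε : ℤ) (k : ℤ) : ℝ :=
  ∑ i ∈ Finset.Icc (1:ℤ) n, p i * BHK p ε i k

lemma pos_left_aux {a b : ℝ} (h : 0 < a * b) (hb : 0 ≤ b) : 0 < a := by
  by_contra! ha
  exact absurd h (not_lt.2 (mul_nonpos_of_nonpos_of_nonneg ha hb))


/-- mass of the window is positive -/
lemma mass_pos (p : ℤ → ℝ) (h0 : ∀ m, 0 ≤ p m) (ε j : ℤ) (hε : 1 ≤ ε) (hj : 0 < p j) :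
    0 < ∑ k ∈ Finset.Icc (j - ε) (j + ε), p k :=
  Finset.sum_pos' (fun k _ => h0 k) ⟨j, by simp; omega, hj⟩

/-- shifted first moment -/
lemma moment_eq (p : ℤ → ℝ) (h0 : ∀ m, 0 ≤ p m) (ε j : ℤ) (hε : 1 ≤ ε) (hj : 0 < p j) (c : ℝ) :
    ∑ k ∈ Finset.Icc (j - ε) (j + ε), ((k:ℝ) - c) * p k =
      (locM p ε j - c) * ∑ k ∈ Finset.Icc (j - ε) (j + ε), p k := by
  have hm := mass_pos p h0 ε j hε hj
  have : locM p ε j * ∑ k ∈ Finset.Icc (j - ε) (j + ε), p k =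
      ∑ k ∈ Finset.Icc (j - ε) (j + ε), (k:ℝ) * p k := by
    unfold locM Mbary
    rw [if_pos hm.ne', div_mul_cancel₀ _ hm.ne']
  rw [sub_mul, this, Finset.mul_sum, ← Finset.sum_sub_distrib]
  exact Finset.sum_congr rfl (fun k _ => by ring)

/-- restrict a window sum to a larger interval through an indicator -/
lemma window_sum (T : Finset ℤ) (ε j : ℤ) (hT : Finset.Icc (j - ε) (j + ε) ⊆ T) (f : ℤ → ℝ) :
    ∑ k ∈ Finset.Icc (j - ε) (j + ε), f k =
      ∑ k ∈ T, if (j - ε ≤ k ∧ k ≤ j + ε) then f k else 0 := by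
  rw [← Finset.sum_filter]
  congr 1
  ext k
  simp only [Finset.mem_Icc, Finset.mem_filter]
  constructor
  · intro h
    exact ⟨hT (by simpa using h), h⟩
  · exact fun h => h.2

/-- the local mean is monotone on the support -/
lemma locM_mono (p : ℤ → ℝ) (h0 : ∀ m, 0 ≤ p m) (ε i j : ℤ) (hε : 1 ≤ ε)
    (hi : 0 < p i) (hj : 0 < p j) (hij : i ≤ j) : locM p ε i ≤ locM p ε j := by
  have mi := mass_pos p h0 ε i hε hi
  have mj := mass_pos p h0 ε j hε hj
  have ei := moment_eq p h0 ε i hε hi 0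
  have ej := moment_eq p h0 ε j hε hj 0
  simp only [sub_zero] at ei ej
  set T := Finset.Icc (i - ε) (j + ε) with hT
  have ti : Finset.Icc (i - ε) (i + ε) ⊆ T := Finset.Icc_subset_Icc le_rfl (by omega)
  have tj : Finset.Icc (j - ε) (j + ε) ⊆ T := Finset.Icc_subset_Icc (by omega) le_rfl
  rw [window_sum T ε i ti, window_sum T ε i ti] at ei
  rw [window_sum T ε j tj, window_sum T ε j tj] at ej
  rw [window_sum T ε i ti] at mi
  rw [window_sum T ε j tj] at mj
  set A : ℤ → ℝ := fun k => if (i - ε ≤ k ∧ k ≤ i + ε) then p k else 0 with hA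
  set B : ℤ → ℝ := fun k => if (j - ε ≤ k ∧ k ≤ j + ε) then p k else 0 with hB
  have ei' : ∑ k ∈ T, (k:ℝ) * A k = locM p ε i * ∑ k ∈ T, A k := by
    rw [← ei]; exact Finset.sum_congr rfl (fun k _ => by simp only [hA]; split_ifs <;> simp)
  have ej' : ∑ k ∈ T, (k:ℝ) * B k = locM p ε j * ∑ k ∈ T, B k := by
    rw [← ej]; exact Finset.sum_congr rfl (fun k _ => by simp only [hB]; split_ifs <;> simp)
  have mi' : 0 < ∑ k ∈ T, A k := mi
  have mj' : 0 < ∑ k ∈ T, B k := mj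
  have key : 0 ≤ ∑ k ∈ T, ∑ l ∈ T, ((l:ℝ) - k) * (A k * B l - A l * B k) := by
    refine Finset.sum_nonneg (fun k _ => Finset.sum_nonneg (fun l _ => ?_))
    have hk := h0 k
    have hl := h0 l
    have hkl := mul_nonneg hk hl
    rcases le_total k l with h | h
    · have h' : (0:ℝ) ≤ (l:ℝ) - k := by exact_mod_cast sub_nonneg.2 h
      refine mul_nonneg h' ?_
      simp only [hA, hB]
      split_ifs <;> first | omega | nlinarith
    · have h' : (l:ℝ) - k ≤ 0 := by exact_mod_cast sub_nonpos.2 h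
      refine mul_nonneg_of_nonpos_of_nonpos h' ?_
      simp only [hA, hB]
      split_ifs <;> first | omega | nlinarith
  have e1 : ∑ k ∈ T, ∑ l ∈ T, ((l:ℝ) - k) * (A k * B l - A l * B k) =
      2 * ((∑ k ∈ T, A k) * (∑ k ∈ T, (k:ℝ) * B k) -
        (∑ k ∈ T, (k:ℝ) * A k) * (∑ k ∈ T, B k)) := by
    have : ∀ k l : ℤ, ((l:ℝ) - k) * (A k * B l - A l * B k) =
      A k * ((l:ℝ) * B l) - ((k:ℝ) * A k) * B l - ((l:ℝ) * A l * B k - A l * ((k:ℝ) * B k)) := by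
      intros; ring
    simp only [this, Finset.sum_sub_distrib, ← Finset.mul_sum, ← Finset.sum_mul]
    ring
  rw [e1, ei', ej'] at key
  have : 0 ≤ (locM p ε j - locM p ε i) * ((∑ k ∈ T, A k) * ∑ k ∈ T, B k) := by linarith
  have := nonneg_of_mul_nonneg_left this (mul_pos mi' mj')
  linarith

lemma BHK_eq (p : ℤ → ℝ) (ε i j : ℤ) :
    BHK p ε i j = (if j = ⌊locM p ε i⌋ then (⌊locM p ε i⌋ : ℝ) + 1 - locM p ε i else 0) +
      (if j = ⌊locM p ε i⌋ + 1 then locM p ε i - ⌊locM p ε i⌋ else 0) := by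
  unfold BHK
  generalize locM p ε i = M
  by_cases hM : M = ⌊M⌋
  · obtain ⟨z, rfl⟩ : ∃ z : ℤ, M = z := ⟨_, hM⟩
    simp only [Int.floor_intCast, Int.ceil_intCast, Int.cast_inj]
    split_ifs <;> simp
  · have hc : ⌈M⌉ = ⌊M⌋ + 1 := by
      rw [Int.ceil_eq_iff]
      have h1 := Int.floor_le M
      have h2 := Int.lt_floor_add_one M
      have h3 := lt_of_le_of_ne h1 (Ne.symm hM)
      push_cast
      constructor <;> linarith
    have hj : ¬ ((j:ℝ) = M) := by
      intro h
      apply hM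
      rw [← h, Int.floor_intCast]
    rw [if_neg hj, hc]
    split_ifs <;> first | omega | (push_cast; ring)

/-- mass sent to classes at most k -/
lemma BHK_cum (p : ℤ → ℝ) (ε i n k : ℤ) (h1 : 1 ≤ locM p ε i) (h2 : locM p ε i ≤ n) :
    ∑ m ∈ (Finset.Icc 1 n).filter (fun m => m ≤ k), BHK p ε i m =
      max 0 (min 1 ((k:ℝ) + 1 - locM p ε i)) := by
  simp only [BHK_eq]
  generalize locM p ε i = M at *
  rw [Finset.sum_add_distrib, Finset.sum_ite_eq', Finset.sum_ite_eq']
  have f1 : 1 ≤ ⌊M⌋ := Int.le_floor.2 (by exact_mod_cast h1)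
  have f2 : ⌊M⌋ ≤ n := by
    have := (Int.floor_le M).trans h2
    exact_mod_cast this
  have g1 := Int.floor_le M
  have g2 := Int.lt_floor_add_one M
  have e : (if ⌊M⌋ + 1 ∈ (Finset.Icc 1 n).filter (fun m => m ≤ k) then M - ⌊M⌋ else 0) =
      (if ⌊M⌋ + 1 ≤ k then M - ⌊M⌋ else 0) := by
    by_cases h : ⌊M⌋ + 1 ≤ n
    · have : (⌊M⌋ + 1 ∈ (Finset.Icc 1 n).filter (fun m => m ≤ k)) ↔ ⌊M⌋ + 1 ≤ k := by
        simp only [Finset.mem_filter, Finset.mem_Icc]; omega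
      simp only [this]
    · have hn : ⌊M⌋ = n := by omega
      have : M - ⌊M⌋ = 0 := by rw [hn] at g1 ⊢; linarith
      rw [this]; simp
  have e' : (⌊M⌋ ∈ (Finset.Icc 1 n).filter (fun m => m ≤ k)) ↔ ⌊M⌋ ≤ k := by
    simp only [Finset.mem_filter, Finset.mem_Icc]; omega
  rw [e]
  simp only [e']
  rcases lt_trichotomy ⌊M⌋ k with h | h | h
  · have h' : (⌊M⌋:ℝ) + 1 ≤ k := by exact_mod_cast h
    rw [if_pos (by omega), if_pos (by omega), min_eq_left (by linarith), max_eq_right (by norm_num)]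
    ring
  · rw [if_pos (by omega), if_neg (by omega), h]
    rw [h] at g1 g2
    rw [min_eq_right (by linarith), max_eq_right (by linarith)]
    ring
  · have h' : (k:ℝ) + 1 ≤ ⌊M⌋ := by exact_mod_cast h
    rw [if_neg (by omega), if_neg (by omega), max_eq_left]
    · ring
    · exact (min_le_right _ _).trans (by linarith)

lemma locM_mem (p : ℤ → ℝ) (n ε j : ℤ) (hε : 1 ≤ ε) (hp : IsDist n p) (hj : 0 < p j) :
    1 ≤ locM p ε j ∧ locM p ε j ≤ n := by
  obtain ⟨h0, hout, -⟩ := hp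
  have m := mass_pos p h0 ε j hε hj
  have hz : ∀ k, p k = 0 ∨ (1 ≤ (k:ℝ) ∧ (k:ℝ) ≤ n) := by
    intro k
    by_cases h : k ∈ Finset.Icc (1:ℤ) n
    · right
      rw [Finset.mem_Icc] at h
      exact ⟨by exact_mod_cast h.1, by exact_mod_cast h.2⟩
    · exact Or.inl (hout k h)
  constructor
  · have e := moment_eq p h0 ε j hε hj 1
    have : 0 ≤ ∑ k ∈ Finset.Icc (j - ε) (j + ε), ((k:ℝ) - 1) * p k := by
      refine Finset.sum_nonneg (fun k _ => ?_)
      rcases hz k with h | h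
      · simp [h]
      · exact mul_nonneg (by linarith) (h0 k)
    rw [e] at this
    linarith [nonneg_of_mul_nonneg_left this m]
  · have e := moment_eq p h0 ε j hε hj n
    have : 0 ≤ - ∑ k ∈ Finset.Icc (j - ε) (j + ε), ((k:ℝ) - n) * p k := by
      rw [← Finset.sum_neg_distrib]
      refine Finset.sum_nonneg (fun k _ => ?_)
      rcases hz k with h | h
      · simp [h]
      · have := mul_nonneg (sub_nonneg.2 h.2) (h0 k)
        linarith
    rw [e, ← neg_mul] at this
    linarith [nonneg_of_mul_nonneg_left this m]

/-- conservation across the cut k | k+1 -/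
lemma cut (n ε : ℤ) (hε : 1 ≤ ε) (p : ℤ → ℝ) (hp : IsDist n p)
    (hfix : ∀ k ∈ Finset.Icc (1:ℤ) n, stepHK n p ε k = p k) (k : ℤ) :
    ∑ j ∈ Finset.Icc (1:ℤ) n,
      p j * (max 0 (min 1 ((k:ℝ) + 1 - locM p ε j)) - if j ≤ k then 1 else 0) = 0 := by
  have h : ∑ m ∈ (Finset.Icc 1 n).filter (fun m => m ≤ k), stepHK n p ε m =
      ∑ m ∈ (Finset.Icc 1 n).filter (fun m => m ≤ k), p m :=
    Finset.sum_congr rfl (fun m hm => hfix m (Finset.mem_filter.1 hm).1)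
  unfold stepHK at h
  rw [Finset.sum_comm, Finset.sum_filter (fun m => m ≤ k)] at h
  rw [← sub_eq_zero, ← Finset.sum_sub_distrib] at h
  refine Eq.trans ?_ h
  refine Finset.sum_congr rfl (fun j _ => ?_)
  rw [← Finset.mul_sum]
  rcases (hp.1 j).eq_or_lt with h | h
  · simp [← h]
  · obtain ⟨a, b⟩ := locM_mem p n ε j hε hp h
    rw [BHK_cum p ε j n k a b, mul_sub]
    simp

lemma supp_mem (n : ℤ) (p : ℤ → ℝ) (hp : IsDist n p) (j : ℤ) (hj : 0 < p j) :
    j ∈ Finset.Icc (1:ℤ) n := by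
  by_contra h
  exact hj.ne' (hp.2.1 j h)

lemma locM_lt (n ε : ℤ) (hε : 1 ≤ ε) (p : ℤ → ℝ) (hp : IsDist n p)
    (hfix : ∀ k ∈ Finset.Icc (1:ℤ) n, stepHK n p ε k = p k) (j : ℤ) (hj : 0 < p j) :
    locM p ε j < j + 1 := by
  by_contra! hc
  have h := cut n ε hε p hp hfix j
  have : ∑ l ∈ Finset.Icc (1:ℤ) n,
      p l * (max 0 (min 1 ((j:ℝ) + 1 - locM p ε l)) - if l ≤ j then 1 else 0) <
      ∑ l ∈ Finset.Icc (1:ℤ) n, 0 := by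
    refine Finset.sum_lt_sum (fun l _ => ?_) ⟨j, supp_mem n p hp j hj, ?_⟩
    · rcases (hp.1 l).eq_or_lt with h | h
      · simp [← h]
      · refine mul_nonpos_of_nonneg_of_nonpos h.le ?_
        split_ifs with hl
        · have : max 0 (min 1 ((j:ℝ) + 1 - locM p ε l)) ≤ 1 :=
            max_le (by norm_num) (min_le_left _ _)
          linarith
        · have := locM_mono p hp.1 ε j l hε hj h (by omega)
          rw [max_eq_left ((min_le_right _ _).trans (by linarith))]
          simp
    · rw [max_eq_left ((min_le_right _ _).trans (by linarith))]
      simp [hj]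
  simp at this
  linarith

lemma lt_locM (n ε : ℤ) (hε : 1 ≤ ε) (p : ℤ → ℝ) (hp : IsDist n p)
    (hfix : ∀ k ∈ Finset.Icc (1:ℤ) n, stepHK n p ε k = p k) (j : ℤ) (hj : 0 < p j) :
    (j:ℝ) - 1 < locM p ε j := by
  by_contra! hc
  have h := cut n ε hε p hp hfix (j - 1)
  have : ∑ l ∈ Finset.Icc (1:ℤ) n, 0 < ∑ l ∈ Finset.Icc (1:ℤ) n,
      p l * (max 0 (min 1 (((j - 1 : ℤ):ℝ) + 1 - locM p ε l)) - if l ≤ j - 1 then 1 else 0) := by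
    push_cast
    refine Finset.sum_lt_sum (fun l _ => ?_) ⟨j, supp_mem n p hp j hj, ?_⟩
    · rcases (hp.1 l).eq_or_lt with h | h
      · simp [← h]
      · refine mul_nonneg h.le ?_
        split_ifs with hl
        · have := locM_mono p hp.1 ε l j hε h hj (by omega)
          rw [min_eq_left (by linarith), max_eq_right (by norm_num)]
          simp
        · simp
    · rw [min_eq_left (by linarith), max_eq_right (by norm_num), if_neg (by omega)]
      simp [hj]
  simp only [Finset.sum_const_zero] at this
  linarith

/-- balance between neighbouring classes -/
lemma balance (n ε : ℤ) (hε : 1 ≤ ε) (p : ℤ → ℝ) (hp : IsDist n p)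
    (hfix : ∀ k ∈ Finset.Icc (1:ℤ) n, stepHK n p ε k = p k) (k : ℤ) :
    p k * max 0 (locM p ε k - k) = p (k+1) * max 0 ((k:ℝ) + 1 - locM p ε (k+1)) := by
  have h := cut n ε hε p hp hfix k
  have e : ∀ j ∈ Finset.Icc (1:ℤ) n,
      p j * (max 0 (min 1 ((k:ℝ) + 1 - locM p ε j)) - if j ≤ k then 1 else 0) =
      (if j = k then - (p k * max 0 (locM p ε k - k)) else 0) +
      (if j = k + 1 then p (k+1) * max 0 ((k:ℝ) + 1 - locM p ε (k+1)) else 0) := by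
    intro j _
    rcases (hp.1 j).eq_or_lt with h | h
    · have q1 : j = k → p k = 0 := fun g => by rw [← g, ← h]
      have q2 : j = k + 1 → p (k + 1) = 0 := fun g => by rw [← g, ← h]
      rw [← h, zero_mul]
      by_cases g1 : j = k
      · rw [if_pos g1, if_neg (by omega), q1 g1]; ring
      · by_cases g2 : j = k + 1
        · rw [if_neg g1, if_pos g2, q2 g2]; ring
        · rw [if_neg g1, if_neg g2]; ring
    · have a := locM_lt n ε hε p hp hfix j h
      have b := lt_locM n ε hε p hp hfix j h
      rcases lt_trichotomy j k with hjk | rfl | hjk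
      · have : (j:ℝ) + 1 ≤ k := by exact_mod_cast hjk
        rw [min_eq_left (by linarith), max_eq_right (by norm_num), if_pos (by omega),
          if_neg (by omega), if_neg (by omega)]
        simp
      · rw [if_pos le_rfl, if_pos rfl, if_neg (by omega)]
        rcases le_total (locM p ε j) j with g | g
        · rw [min_eq_left (by linarith), max_eq_right (by norm_num), max_eq_left (by linarith)]
          simp
        · rw [min_eq_right (by linarith), max_eq_right (by linarith), max_eq_right (by linarith)]
          ring
      · rw [if_neg (by omega), if_neg (by omega)]
        rcases eq_or_lt_of_le (show k + 1 ≤ j by omega) with rfl | g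
        · push_cast at *
          rw [if_pos rfl, min_eq_right (by linarith)]
          ring
        · have : (k:ℝ) + 1 + 1 ≤ j := by exact_mod_cast g
          rw [if_neg (by omega), max_eq_left ((min_le_right _ _).trans (by linarith))]
          simp
  rw [Finset.sum_congr rfl e, Finset.sum_add_distrib, Finset.sum_ite_eq', Finset.sum_ite_eq'] at h
  have z1 : k ∉ Finset.Icc (1:ℤ) n → p k = 0 := hp.2.1 k
  have z2 : k + 1 ∉ Finset.Icc (1:ℤ) n → p (k+1) = 0 := hp.2.1 (k+1)
  split_ifs at h with h1 h2 h2
  · linarith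
  · rw [z2 h2]; linarith
  · rw [z1 h1]; linarith
  · rw [z1 h1, z2 h2]; simp

lemma case_one (ε : ℤ) (hε : 1 ≤ ε) (p : ℤ → ℝ) (h0 : ∀ m, 0 ≤ p m) (i : ℤ) (hi : 0 < p i)
    (hM : locM p ε i = i) :
    (∀ m ∈ Finset.Icc (i - ε) (i - 1), p m = 0) ↔ (∀ m ∈ Finset.Icc (i + 1) (i + ε), p m = 0) := by
  have e := moment_eq p h0 ε i hε hi i
  rw [hM, sub_self, zero_mul] at e
  constructor
  · intro h m hm
    have hnn : ∀ k ∈ Finset.Icc (i - ε) (i + ε), 0 ≤ ((k:ℝ) - i) * p k := by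
      intro k hk
      rw [Finset.mem_Icc] at hk
      rcases lt_or_ge k i with g | g
      · rw [h k (by rw [Finset.mem_Icc]; omega)]; simp
      · exact mul_nonneg (by exact_mod_cast sub_nonneg.2 g) (h0 k)
    rw [Finset.mem_Icc] at hm
    have := (Finset.sum_eq_zero_iff_of_nonneg hnn).1 e m (by rw [Finset.mem_Icc]; omega)
    refine (mul_eq_zero.1 this).resolve_left ?_
    rw [sub_eq_zero]
    intro hh
    have : m = i := by exact_mod_cast hh
    omega
  · intro h m hm
    have hnn : ∀ k ∈ Finset.Icc (i - ε) (i + ε), ((k:ℝ) - i) * p k ≤ 0 := by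
      intro k hk
      rw [Finset.mem_Icc] at hk
      rcases lt_or_ge i k with g | g
      · rw [h k (by rw [Finset.mem_Icc]; omega)]; simp
      · exact mul_nonpos_of_nonpos_of_nonneg (by exact_mod_cast sub_nonpos.2 g) (h0 k)
    rw [Finset.mem_Icc] at hm
    have := (Finset.sum_eq_zero_iff_of_nonpos hnn).1 e m (by rw [Finset.mem_Icc]; omega)
    refine (mul_eq_zero.1 this).resolve_left ?_
    rw [sub_eq_zero]
    intro hh
    have : m = i := by exact_mod_cast hh
    omega

/-- the part of the moment about μ outside of the two classes c, c+1 -/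
lemma pair_moment (ε : ℤ) (hε : 1 ≤ ε) (p : ℤ → ℝ) (c j : ℤ) (hj : j = c ∨ j = c + 1)
    (μ : ℝ) (hμ : (c - μ) * p c + (c + 1 - μ) * p (c + 1) = 0) :
    ∑ k ∈ Finset.Icc (j - ε) (j + ε), ((k:ℝ) - μ) * p k =
      ∑ k ∈ Finset.Icc (j - ε) (j + ε), if (k = c ∨ k = c + 1) then 0 else ((k:ℝ) - μ) * p k := by
  have : ∀ k ∈ Finset.Icc (j - ε) (j + ε), ((k:ℝ) - μ) * p k =
      (if (k = c ∨ k = c + 1) then 0 else ((k:ℝ) - μ) * p k) +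
      ((if k = c then (c - μ) * p c else 0) +
        if k = c + 1 then (c + 1 - μ) * p (c + 1) else 0) := by
    intro k _
    split_ifs with h1 h2 h3 h3 h4 <;> first | omega | (subst_vars; simp) | simp
  rw [Finset.sum_congr rfl this, Finset.sum_add_distrib, Finset.sum_add_distrib,
    Finset.sum_ite_eq', Finset.sum_ite_eq', if_pos, if_pos, hμ, add_zero]
  all_goals rw [Finset.mem_Icc]; omega

lemma case_two (ε : ℤ) (hε : 1 ≤ ε) (p : ℤ → ℝ) (h0 : ∀ m, 0 ≤ p m) (c : ℤ) (hc : 0 < p c)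
    (hc' : 0 < p (c + 1))
    (hM : p c * (locM p ε c - c) = p (c + 1) * (c + 1 - locM p ε (c + 1))) :
    (∀ m ∈ Finset.Icc (c - ε) (c - 1), p m = 0) ↔
      (∀ m ∈ Finset.Icc (c + 1 + 1) (c + 1 + ε), p m = 0) := by
  obtain ⟨μ, hμ, hμ1, hμ2⟩ : ∃ μ : ℝ, (c - μ) * p c + (c + 1 - μ) * p (c + 1) = 0 ∧
      c < μ ∧ μ < c + 1 := by
    refine ⟨c + p (c+1) / (p c + p (c+1)), ?_, ?_, ?_⟩
    · field_simp; ring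
    · have : 0 < p (c+1) / (p c + p (c+1)) := by positivity
      linarith
    · have : p (c+1) / (p c + p (c+1)) < 1 := by rw [div_lt_one (by positivity)]; linarith
      linarith
  have m1 := mass_pos p h0 ε c hε hc
  have m2 := mass_pos p h0 ε (c+1) hε hc'
  have e1 := moment_eq p h0 ε c hε hc μ
  have e2 := moment_eq p h0 ε (c+1) hε hc' μ
  rw [pair_moment ε hε p c c (Or.inl rfl) μ hμ] at e1
  rw [pair_moment ε hε p c (c+1) (Or.inr rfl) μ hμ] at e2
  have hs : p c * (locM p ε c - μ) + p (c+1) * (locM p ε (c+1) - μ) = 0 := by linarith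
  constructor
  · intro h m hm
    rw [Finset.mem_Icc] at hm
    by_contra hne
    have hpm := lt_of_le_of_ne (h0 m) (Ne.symm hne)
    have hnn : ∀ k, c - ε ≤ k →
        0 ≤ if (k = c ∨ k = c + 1) then (0:ℝ) else ((k:ℝ) - μ) * p k := by
      intro k hk
      split_ifs with g
      · exact le_rfl
      · rcases lt_or_ge k c with g' | g'
        · rw [h k (by rw [Finset.mem_Icc]; omega)]; simp
        · have : (c:ℝ) + 1 ≤ k := by exact_mod_cast (show c + 1 ≤ k by omega)
          exact mul_nonneg (by linarith) (h0 k)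
    have a1 := Finset.sum_nonneg (s := Finset.Icc (c - ε) (c + ε))
      (fun k hk => hnn k (Finset.mem_Icc.1 hk).1)
    have a2 := Finset.sum_pos' (s := Finset.Icc (c + 1 - ε) (c + 1 + ε))
      (fun k hk => hnn k (by rw [Finset.mem_Icc] at hk; omega))
      ⟨m, by rw [Finset.mem_Icc]; omega, by
        rw [if_neg (by omega)]
        have : (c:ℝ) + 1 ≤ m := by exact_mod_cast (show c + 1 ≤ m by omega)
        exact mul_pos (by linarith) hpm⟩
    rw [e1] at a1
    rw [e2] at a2
    have b1 := nonneg_of_mul_nonneg_left a1 m1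
    have b2 := pos_left_aux a2 m2.le
    nlinarith [mul_nonneg hc.le b1, mul_pos hc' b2]
  · intro h m hm
    rw [Finset.mem_Icc] at hm
    by_contra hne
    have hpm := lt_of_le_of_ne (h0 m) (Ne.symm hne)
    have hnn : ∀ k, k ≤ c + 1 + ε →
        0 ≤ - if (k = c ∨ k = c + 1) then (0:ℝ) else ((k:ℝ) - μ) * p k := by
      intro k hk
      split_ifs with g
      · simp
      · rcases lt_or_ge (c + 1) k with g' | g'
        · rw [h k (by rw [Finset.mem_Icc]; omega)]; simp
        · have : (k:ℝ) ≤ c := by exact_mod_cast (show k ≤ c by omega)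
          rw [← neg_mul]
          exact mul_nonneg (by linarith) (h0 k)
    have a2 := Finset.sum_nonneg (s := Finset.Icc (c + 1 - ε) (c + 1 + ε))
      (fun k hk => hnn k (Finset.mem_Icc.1 hk).2)
    have a1 := Finset.sum_pos' (s := Finset.Icc (c - ε) (c + ε))
      (fun k hk => hnn k (by rw [Finset.mem_Icc] at hk; omega))
      ⟨m, by rw [Finset.mem_Icc]; omega, by
        rw [if_neg (by omega), ← neg_mul]
        have : (m:ℝ) ≤ c := by exact_mod_cast (show m ≤ c by omega)
        exact mul_pos (by linarith) hpm⟩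
    rw [Finset.sum_neg_distrib, e1, ← neg_mul] at a1
    rw [Finset.sum_neg_distrib, e2, ← neg_mul] at a2
    have b1 := pos_left_aux a1 m1.le
    have b2 := nonneg_of_mul_nonneg_left a2 m2
    nlinarith [mul_pos hc b1, mul_nonneg hc'.le b2]

lemma min_max_pair (S : Finset ℤ) (a b : ℤ) (hab : a ≤ b) (ha : a ∈ S) (hb : b ∈ S)
    (h : ∀ j ∈ S, a ≤ j ∧ j ≤ b) (hne : S.Nonempty) : S.min' hne = a ∧ S.max' hne = b :=
  ⟨le_antisymm (S.min'_le a ha) (h _ (S.min'_mem hne)).1,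
   le_antisymm (h _ (S.max'_mem hne)).2 (S.le_max' b hb)⟩

/-- in a fixed point of the HK interactive Markov chain, for a class `i`
with positive mass and `S = {j ∈ {1,…,n} | p j > 0 ∧ i-1 < M_j < i+1}` with minimum `a`
and maximum `b`, the mass vanishes on `[a-ε..a-1]` iff it vanishes on `[b+1..b+ε]`. -/
theorem hk_chain_fixed_sides (n ε : ℤ) (hn : 1 ≤ n) (hε : 1 ≤ ε)
    (p : ℤ → ℝ) (hp : IsDist n p)
    (hfix : ∀ k ∈ Finset.Icc (1:ℤ) n, stepHK n p ε k = p k)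
    (i : ℤ) (hi : i ∈ Finset.Icc (1:ℤ) n) (hpi : 0 < p i)
    (S : Finset ℤ)
    (hS : S = (Finset.Icc (1:ℤ) n).filter
      (fun j => 0 < p j ∧ (i:ℝ) - 1 < locM p ε j ∧ locM p ε j < (i:ℝ) + 1)) :
    ∃ hne : S.Nonempty, i ∈ S ∧
      ((∀ m ∈ Finset.Icc (S.min' hne - ε) (S.min' hne - 1), p m = 0) ↔
       (∀ m ∈ Finset.Icc (S.max' hne + 1) (S.max' hne + ε), p m = 0)) := by
  have h0 := hp.1
  have hmem : ∀ j, j ∈ S ↔ (0 < p j ∧ (i:ℝ) - 1 < locM p ε j ∧ locM p ε j < (i:ℝ) + 1) := by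
    intro j
    rw [hS, Finset.mem_filter]
    exact ⟨fun h => h.2, fun h => ⟨supp_mem n p hp j h.1, h⟩⟩
  have hlt := locM_lt n ε hε p hp hfix
  have hgt := lt_locM n ε hε p hp hfix
  have hiS : i ∈ S := (hmem i).2 ⟨hpi, hgt i hpi, hlt i hpi⟩
  have hne : S.Nonempty := ⟨i, hiS⟩
  have hrange : ∀ j ∈ S, i - 1 ≤ j ∧ j ≤ i + 1 := by
    intro j hj
    obtain ⟨a, b, c⟩ := (hmem j).1 hj
    have b' := hlt j a
    have c' := hgt j a
    have h1 : i - 1 < j + 1 := by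
      have : (i:ℝ) - 1 < j + 1 := by linarith
      exact_mod_cast this
    have h2 : j - 1 < i + 1 := by
      have : (j:ℝ) - 1 < i + 1 := by linarith
      exact_mod_cast this
    omega
  have bR := balance n ε hε p hp hfix i
  have bL := balance n ε hε p hp hfix (i - 1)
  rw [sub_add_cancel] at bL
  push_cast at bL
  rw [sub_add_cancel] at bL
  -- a neighbour in S has positive flow towards i
  have hL : i - 1 ∈ S → 0 < p (i-1) * max 0 (locM p ε (i-1) - ((i:ℝ) - 1)) := by
    intro h
    obtain ⟨a, b, -⟩ := (hmem _).1 h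
    exact mul_pos a (lt_max_of_lt_right (by linarith))
  have hR : i + 1 ∈ S → 0 < p (i+1) * max 0 ((i:ℝ) + 1 - locM p ε (i+1)) := by
    intro h
    obtain ⟨a, -, b⟩ := (hmem _).1 h
    exact mul_pos a (lt_max_of_lt_right (by linarith))
  refine ⟨hne, hiS, ?_⟩
  rcases lt_trichotomy (locM p ε i) i with hM | hM | hM
  · have nR : i + 1 ∉ S := by
      intro h
      have := hR h
      rw [← bR, max_eq_left (by linarith)] at this
      simp at this
    have pos : 0 < p i * max 0 ((i:ℝ) - locM p ε i) :=
      mul_pos hpi (lt_max_of_lt_right (by linarith))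
    rw [← bL] at pos
    have p1 : 0 < p (i-1) := pos_left_aux pos (le_max_left _ _)
    have p2 : 0 < locM p ε (i-1) - ((i:ℝ) - 1) := by
      by_contra! hh
      rw [max_eq_left hh] at pos
      simp at pos
    have hm := locM_mono p h0 ε (i-1) i hε p1 hpi (by omega)
    have iL : i - 1 ∈ S := (hmem _).2 ⟨p1, by linarith, by linarith⟩
    obtain ⟨ea, eb⟩ := min_max_pair S (i-1) i (by omega) iL hiS (fun j hj => by
      have := hrange j hj
      have : j ≠ i + 1 := fun h => nR (h ▸ hj)
      omega) hne
    rw [ea, eb]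
    rw [max_eq_right p2.le, max_eq_right (by linarith)] at bL
    have := case_two ε hε p h0 (i-1) p1 (by simpa using hpi) (by
      rw [sub_add_cancel]; push_cast; rw [sub_add_cancel]; exact bL)
    rw [sub_add_cancel] at this
    exact this
  · have nR : i + 1 ∉ S := by
      intro h
      have := hR h
      rw [← bR, max_eq_left (by linarith)] at this
      simp at this
    have nL : i - 1 ∉ S := by
      intro h
      have := hL h
      rw [bL, max_eq_left (by linarith)] at this
      simp at this
    obtain ⟨ea, eb⟩ := min_max_pair S i i le_rfl hiS hiS (fun j hj => by
      have := hrange j hj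
      have : j ≠ i + 1 := fun h => nR (h ▸ hj)
      have : j ≠ i - 1 := fun h => nL (h ▸ hj)
      omega) hne
    rw [ea, eb]
    exact case_one ε hε p h0 i hpi hM
  · have nL : i - 1 ∉ S := by
      intro h
      have := hL h
      rw [bL, max_eq_left (by linarith)] at this
      simp at this
    have pos : 0 < p i * max 0 (locM p ε i - i) :=
      mul_pos hpi (lt_max_of_lt_right (by linarith))
    rw [bR] at pos
    have p1 : 0 < p (i+1) := pos_left_aux pos (le_max_left _ _)
    have p2 : 0 < (i:ℝ) + 1 - locM p ε (i+1) := by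
      by_contra! hh
      rw [max_eq_left hh] at pos
      simp at pos
    have hm := locM_mono p h0 ε i (i+1) hε hpi p1 (by omega)
    have iR : i + 1 ∈ S := (hmem _).2 ⟨p1, by linarith, by linarith⟩
    obtain ⟨ea, eb⟩ := min_max_pair S i (i+1) (by omega) hiS iR (fun j hj => by
      have := hrange j hj
      have : j ≠ i - 1 := fun h => nL (h ▸ hj)
      omega) hne
    rw [ea, eb]
    rw [max_eq_right p2.le, max_eq_right (by linarith)] at bR
    exact case_two ε hε p h0 i hpi p1 bR
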